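/- For every bounded rectangle A in [0,1]^d and all reals x < y (y = +∞ allowed, with the conventions u_N(+∞) = +∞ and e^{−∞} = 0), the sum over α ∈ nA ∩ V_N of P(u_N(x) < φ_α ≤ u_N(y)) converges, as n → ∞, to |A|·(e^{−x} − e^{−y}). -/

import Mathlib

open MeasureTheory ProbabilityTheory Real Filter Set

/-- `ℤ^d` as functions `Fin d → ℤ`. -/
abbrev Zd (d : ℕ) := Fin d → ℤ

/-- One step of the simple random walk: move from `a` by `±1` in coordinate `i`. -/
def rwStep (d : ℕ) (i : Fin d) (s : Bool) (a : Zd d) : Zd d :=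
  Function.update a i (a i + if s then 1 else -1)

/-- `m`-step transition probability of the simple random walk on `ℤ^d`. -/
noncomputable def rwP (d : ℕ) : ℕ → Zd d → Zd d → ℝ
  | 0, a, b => if a = b then 1 else 0
  | (m+1), a, b => (1 / (2 * d)) * ∑ i : Fin d, ∑ s : Bool, rwP d m (rwStep d i s a) b

/-- The Green's function `g(a,b)` of the simple random walk on `ℤ^d`. -/
noncomputable def green (d : ℕ) (a b : Zd d) : ℝ := ∑' m, rwP d m a b

open Classical in
/-- Probability that the walk started at `a` is at `b` at time `m`, having stayed in `Λ`
at all times `0,…,m`. -/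
noncomputable def rwPIn (d : ℕ) (Λ : Set (Zd d)) : ℕ → Zd d → Zd d → ℝ
  | 0, a, b => if a = b ∧ a ∈ Λ then 1 else 0
  | (m+1), a, b =>
      if a ∈ Λ then (1 / (2 * d)) * ∑ i : Fin d, ∑ s : Bool, rwPIn d Λ m (rwStep d i s a) b
      else 0

/-- Dirichlet Green's function `g_Λ(a,b)` (killed upon exiting `Λ`). -/
noncomputable def greenIn (d : ℕ) (Λ : Set (Zd d)) (a b : Zd d) : ℝ := ∑' m, rwPIn d Λ m a b

open Classical in
/-- Probability that the walk started at `a` first hits `F` at time `m`, at the point `b`. -/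
noncomputable def hitP (d : ℕ) (F : Set (Zd d)) : ℕ → Zd d → Zd d → ℝ
  | 0, a, b => if a = b ∧ b ∈ F then 1 else 0
  | (m+1), a, b =>
      if a ∈ F then 0
      else (1 / (2 * d)) * ∑ i : Fin d, ∑ s : Bool, hitP d F m (rwStep d i s a) b

open Classical in
/-- Probability that the walk started at `a` first hits `F` at time `m`, at the point `b`,
before exiting `Λ`. -/
noncomputable def hitPIn (d : ℕ) (Λ F : Set (Zd d)) : ℕ → Zd d → Zd d → ℝ
  | 0, a, b => if a = b ∧ b ∈ F ∧ b ∈ Λ then 1 else 0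
  | (m+1), a, b =>
      if a ∈ Λ ∧ a ∉ F then
        (1 / (2 * d)) * ∑ i : Fin d, ∑ s : Bool, hitPIn d Λ F m (rwStep d i s a) b
      else 0

/-- `ℙ_a(H_F < ∞, S_{H_F} = b)`, the harmonic measure of `F` seen from `a`. -/
noncomputable def hitMeas (d : ℕ) (F : Set (Zd d)) (a b : Zd d) : ℝ := ∑' m, hitP d F m a b

/-- `ℙ_a(H_F < H_{ℤ^d∖Λ}, S_{H_F} = b)`. -/
noncomputable def hitMeasIn (d : ℕ) (Λ F : Set (Zd d)) (a b : Zd d) : ℝ :=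
  ∑' m, hitPIn d Λ F m a b

/-- `(φ_a)_{a∈ℤ^d}` is a centered Gaussian field with covariance `G`: every finite linear
combination is a centered Gaussian with the prescribed variance. -/
def IsGaussianField {Ω : Type*} [MeasurableSpace Ω] (P : Measure Ω) (d : ℕ)
    (G : Zd d → Zd d → ℝ) (φ : Zd d → Ω → ℝ) : Prop :=
  (∀ a, Measurable (φ a)) ∧
    ∀ c : Zd d →₀ ℝ,
      Measure.map (fun ω => ∑ a ∈ c.support, c a * φ a ω) P =
        gaussianReal 0
          (Real.toNNReal (∑ a ∈ c.support, ∑ b ∈ c.support, c a * c b * G a b))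

/-- The centering sequence `b_N` (here `g0 = g(0)` is the variance of the field). -/
noncomputable def bN (g0 : ℝ) (N : ℕ) : ℝ :=
  Real.sqrt g0 * (Real.sqrt (2 * Real.log N) -
    (Real.log (Real.log N) + Real.log (4 * π)) / (2 * Real.sqrt (2 * Real.log N)))

/-- The scaling sequence `a_N = g(0)/b_N`. -/
noncomputable def aN (g0 : ℝ) (N : ℕ) : ℝ := g0 / bN g0 N

/-- `u_N(z) = a_N z + b_N`. -/
noncomputable def uN (g0 : ℝ) (N : ℕ) (z : ℝ) : ℝ := aN g0 N * z + bN g0 N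

/-- The box `V_N = ([0,n-1]^d) ∩ ℤ^d`, `N = n^d`. -/
noncomputable def VN (d n : ℕ) : Finset (Zd d) :=
  Fintype.piFinset fun _ => Finset.Icc (0 : ℤ) ((n : ℤ) - 1)

/-- The `ℓ∞` distance between two points of `ℤ^d`, as a real number. -/
noncomputable def distInf (d : ℕ) (a b : Zd d) : ℝ :=
  ((Finset.univ.sup fun i => (a i - b i).natAbs : ℕ) : ℝ)

open Classical in
/-- The bulk `V_N^δ` of the box `V_N`. -/
noncomputable def bulk (d n : ℕ) (δ : ℝ) : Finset (Zd d) :=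
  (VN d n).filter fun a => ∀ b : Zd d, b ∉ VN d n → δ * n < distInf d a b

/-- The rectangle `∏_i ([0,1] ∩ (lo i, hi i])` in `[0,1]^d`. -/
def rect (d : ℕ) (lo hi : Fin d → ℝ) : Set (Fin d → ℝ) :=
  {t | ∀ i, t i ∈ Set.Icc (0 : ℝ) 1 ∩ Set.Ioc (lo i) (hi i)}

open Classical in
/-- `nA ∩ V_N = {α ∈ V_N : α/n ∈ A}` for the rectangle `A = rect d lo hi`. -/
noncomputable def rectIdx (d n : ℕ) (lo hi : Fin d → ℝ) : Finset (Zd d) :=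
  (VN d n).filter fun a => (fun i => (a i : ℝ) / n) ∈ rect d lo hi

/-- `e^{-y}` for `y ∈ (-∞,+∞]`, with the convention `e^{-∞} = 0`. -/
noncomputable def expE (y : EReal) : ℝ := if y = ⊤ then 0 else Real.exp (-y.toReal)

/-- `u_N` extended to `(-∞,+∞]` by `u_N(+∞) = +∞`. -/
noncomputable def uNE (g0 : ℝ) (N : ℕ) (y : EReal) : EReal :=
  if y = ⊤ then ⊤ else ((uN g0 N y.toReal : ℝ) : EReal)

/-- `ω(R) = ∫_R e^{-z} dz` for `R ⊆ (-∞,+∞]`. -/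
noncomputable def omegaMeas (R : Set EReal) : ℝ :=
  ∫ t in {t : ℝ | (t : EReal) ∈ R}, Real.exp (-t)

/-- `R ⊆ (-∞,+∞]` is a finite union of disjoint intervals `(x,y]` with
`-∞ < x < y ≤ +∞`. -/
def IsFiniteUnionIoc (R : Set EReal) : Prop :=
  ∃ (m : ℕ) (w : Fin m → ℝ) (r : Fin m → EReal),
    (∀ l, (w l : EReal) < r l) ∧
    (Pairwise fun l l' =>
      Disjoint (Set.Ioc (w l : EReal) (r l)) (Set.Ioc (w l' : EReal) (r l'))) ∧
    R = ⋃ l, Set.Ioc ((w l : ℝ) : EReal) (r l)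


lemma rpow_neg_quarter_one_add_le {s : ℝ} (hs : |s| ≤ 1 / 20) :
    (1 + s) ^ (-(1 / 4) : ℝ) ≤ 1 - s / 4 + 11 / 64 * s ^ 2 := by
  obtain ⟨h1, h2⟩ := abs_le.1 hs
  have hpos : 0 < 1 + s := by linarith
  have hq : 0 < 1 - s / 4 + 11 / 64 * s ^ 2 := by nlinarith [sq_nonneg s]
  have hq4 : 1 ≤ (1 - s / 4 + 11 / 64 * s ^ 2) ^ 4 * (1 + s) := by
    have hsq : 0 ≤ s ^ 2 := sq_nonneg s
    have hL : 0 ≤ 1 - s / 2 + 51 / 128 * s ^ 2 := by nlinarith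
    have hL2 : 1 - s / 2 + 51 / 128 * s ^ 2 ≤ (1 - s / 4 + 11 / 64 * s ^ 2) ^ 2 := by
      nlinarith [mul_nonneg hsq (by linarith : 0 ≤ 1 - 11 * s), sq_nonneg (s ^ 2)]
    have hL4 : 1 - s + 134 / 128 * s ^ 2 - 51 / 128 * s ^ 3 ≤
        (1 - s / 2 + 51 / 128 * s ^ 2) ^ 2 := by
      nlinarith [sq_nonneg (s ^ 2)]
    calc 1 ≤ (1 - s + 134 / 128 * s ^ 2 - 51 / 128 * s ^ 3) * (1 + s) := by
          nlinarith [mul_nonneg hsq (by nlinarith : 0 ≤ 6 + 83 * s - 51 * s ^ 2)]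
      _ ≤ (1 - s / 2 + 51 / 128 * s ^ 2) ^ 2 * (1 + s) := by gcongr
      _ ≤ ((1 - s / 4 + 11 / 64 * s ^ 2) ^ 2) ^ 2 * (1 + s) := by gcongr
      _ = _ := by ring
  rw [rpow_neg hpos.le, inv_le_comm₀ (rpow_pos_of_pos hpos _) hq, one_div]
  refine (Real.le_rpow_inv_iff_of_pos (inv_nonneg.2 hq.le) hpos.le (by norm_num)).2 ?_
  rw [show ((4 : ℝ)) = ((4 : ℕ) : ℝ) by norm_num, rpow_natCast, inv_pow]
  rwa [inv_le_iff_one_le_mul₀' (by positivity)]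

/-- A function with negative discrete Laplacian, witnessing transience of the walk for `d ≥ 3`. -/
noncomputable def lyapunov (d : ℕ) (a : Zd d) : ℝ :=
  (900 + ∑ i, (a i : ℝ) ^ 2) ^ (-(1 / 4) : ℝ)

lemma lyapunov_pos (d : ℕ) (a : Zd d) : 0 < lyapunov d a := by
  unfold lyapunov; positivity

lemma sum_sq_rwStep (d : ℕ) (i : Fin d) (s : Bool) (a : Zd d) :
    ∑ j, (rwStep d i s a j : ℝ) ^ 2 =
      ∑ j, (a j : ℝ) ^ 2 + (1 + 2 * (if s then 1 else -1) * (a i : ℝ)) := by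
  rw [← Finset.add_sum_erase _ _ (Finset.mem_univ i),
    ← Finset.add_sum_erase (a := i) _ (fun j => (a j : ℝ) ^ 2) (Finset.mem_univ i)]
  have : ∑ j ∈ Finset.univ.erase i, (rwStep d i s a j : ℝ) ^ 2 =
      ∑ j ∈ Finset.univ.erase i, (a j : ℝ) ^ 2 := by
    refine Finset.sum_congr rfl fun j hj => ?_
    simp [rwStep, Function.update_of_ne (Finset.ne_of_mem_erase hj)]
  rw [this]
  cases s <;> simp [rwStep] <;> ring

lemma lyapunov_rwStep_le (d : ℕ) (i : Fin d) (s : Bool) (a : Zd d) {r t : ℝ}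
    (hr : r = 900 + ∑ j, (a j : ℝ) ^ 2) (ht : t = (1 + 2 * (if s then 1 else -1) * (a i : ℝ)) / r) :
    lyapunov d (rwStep d i s a) ≤ lyapunov d a * (1 - t / 4 + 11 / 64 * t ^ 2) := by
  have hri : 900 + (a i : ℝ) ^ 2 ≤ r := by
    rw [hr]
    gcongr
    exact Finset.single_le_sum (f := fun j => (a j : ℝ) ^ 2) (fun j _ => sq_nonneg _)
      (Finset.mem_univ i)
  have hr0 : 0 < r := by nlinarith [sq_nonneg (a i : ℝ)]
  have hts : |t| ≤ 1 / 20 := by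
    rw [ht, abs_div, abs_of_pos hr0, div_le_iff₀ hr0, abs_le]
    cases s <;> constructor <;>
      simp <;> nlinarith [sq_nonneg ((a i : ℝ) - 20), sq_nonneg ((a i : ℝ) + 20)]
  have hmul : 900 + ∑ j, (rwStep d i s a j : ℝ) ^ 2 = r * (1 + t) := by
    rw [sum_sq_rwStep, ht, hr, mul_add, mul_div_cancel₀ _ (hr ▸ hr0.ne')]
    ring
  unfold lyapunov
  rw [hmul, ← hr, mul_rpow hr0.le (by linarith [(abs_le.1 hts).1])]
  gcongr
  exact rpow_neg_quarter_one_add_le hts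

lemma lyapunov_average_le (d : ℕ) (hd : 3 ≤ d) (a : Zd d) :
    (1 / (2 * d)) * ∑ i : Fin d, ∑ s : Bool, lyapunov d (rwStep d i s a) ≤
      lyapunov d a * (1 - 1 / (48 * (900 + ∑ j, (a j : ℝ) ^ 2))) := by
  obtain ⟨r, hr⟩ : ∃ r, r = 900 + ∑ j, (a j : ℝ) ^ 2 := ⟨_, rfl⟩
  have hS : ∑ j, (a j : ℝ) ^ 2 = r - 900 := by rw [hr]; ring
  have hr9 : 900 ≤ r := by
    have : 0 ≤ ∑ j, (a j : ℝ) ^ 2 := Finset.sum_nonneg fun j _ => sq_nonneg _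
    linarith
  have hd' : (3 : ℝ) ≤ d := by exact_mod_cast hd
  have h1 : ∀ i : Fin d, ∑ s : Bool, lyapunov d (rwStep d i s a) ≤
      lyapunov d a * (2 - 1 / (2 * r) + 11 / 32 / r ^ 2 + 11 / 8 / r ^ 2 * (a i : ℝ) ^ 2) := by
    intro i
    rw [Fintype.sum_bool]
    refine (add_le_add (lyapunov_rwStep_le d i true a hr rfl)
      (lyapunov_rwStep_le d i false a hr rfl)).trans (le_of_eq ?_)
    simp only [if_true, Bool.false_eq_true, if_false]
    field_simp
    ring
  have h2 : ∑ i : Fin d, ∑ s : Bool, lyapunov d (rwStep d i s a) ≤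
      lyapunov d a * (d * (2 - 1 / (2 * r) + 11 / 32 / r ^ 2) + 11 / 8 / r ^ 2 * (r - 900)) := by
    refine (Finset.sum_le_sum fun i _ => h1 i).trans (le_of_eq ?_)
    rw [← Finset.mul_sum, Finset.sum_add_distrib, ← Finset.mul_sum, hS]
    simp only [Finset.sum_const, Finset.card_univ, Fintype.card_fin, nsmul_eq_mul]
  rw [← hr]
  calc _ ≤ (1 / (2 * d)) * (lyapunov d a *
        (d * (2 - 1 / (2 * r) + 11 / 32 / r ^ 2) + 11 / 8 / r ^ 2 * (r - 900))) := by gcongr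
    _ = lyapunov d a * (1 - 1 / (4 * r) + 11 / 64 / r ^ 2 + 11 / 16 / r ^ 2 * (r - 900) / d) := by
        field_simp
        ring
    _ ≤ lyapunov d a * (1 - 1 / (4 * r) + 11 / 64 / r ^ 2 + 11 / 16 / r ^ 2 * (r - 900) / 3) := by
        have := (lyapunov_pos d a).le
        have : 0 ≤ r - 900 := by linarith
        gcongr
    _ ≤ _ := by
        refine mul_le_mul_of_nonneg_left ?_ (lyapunov_pos d a).le
        have hr0 : 0 < r := by linarith
        have : 1 - 1 / (48 * r) - (1 - 1 / (4 * r) + 11 / 64 / r ^ 2 +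
            11 / 16 / r ^ 2 * (r - 900) / 3) = (11 * 900 / 48 - 11 / 64) / r ^ 2 := by
          field_simp
          ring
        have : 0 ≤ (11 * 900 / 48 - 11 / 64) / r ^ 2 := by positivity
        linarith

lemma rwP_nonneg (d m : ℕ) (a b : Zd d) : 0 ≤ rwP d m a b := by
  induction m generalizing a with
  | zero => simp only [rwP]; split_ifs <;> norm_num
  | succ m ih =>
    exact mul_nonneg (by positivity)
      (Finset.sum_nonneg fun i _ => Finset.sum_nonneg fun s _ => ih _)

lemma sum_range_rwP_le (d : ℕ) (hd : 3 ≤ d) (M : ℕ) (a : Zd d) :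
    lyapunov d 0 / 43200 * ∑ m ∈ Finset.range M, rwP d m a 0 ≤ lyapunov d a := by
  induction M generalizing a with
  | zero => simpa using (lyapunov_pos d a).le
  | succ M ih =>
    rw [Finset.sum_range_succ']
    have hexp : lyapunov d 0 / 43200 * ∑ m ∈ Finset.range M, rwP d (m + 1) a 0 =
        (1 / (2 * d)) * ∑ i : Fin d, ∑ s : Bool,
          lyapunov d 0 / 43200 * ∑ m ∈ Finset.range M, rwP d m (rwStep d i s a) 0 := by
      simp only [rwP, Finset.mul_sum]
      rw [Finset.sum_comm]
      refine Finset.sum_congr rfl fun i _ => ?_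
      rw [Finset.sum_comm]
      refine Finset.sum_congr rfl fun s _ => Finset.sum_congr rfl fun m _ => ?_
      ring
    have hle : (1 / (2 * d)) * ∑ i : Fin d, ∑ s : Bool,
          lyapunov d 0 / 43200 * ∑ m ∈ Finset.range M, rwP d m (rwStep d i s a) 0 ≤
        lyapunov d a * (1 - 1 / (48 * (900 + ∑ j, (a j : ℝ) ^ 2))) := by
      refine le_trans ?_ (lyapunov_average_le d hd a)
      gcongr with i _ s _
      exact ih _
    rw [mul_add, hexp]
    refine (add_le_add_left hle _).trans ?_
    by_cases ha : a = 0
    · subst ha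
      simp only [rwP, if_true]
      apply le_of_eq
      simp
      ring
    · simp only [rwP, if_neg ha, mul_zero, add_zero]
      refine mul_le_of_le_one_right (lyapunov_pos d a).le ?_
      have : 0 ≤ 1 / (48 * (900 + ∑ j, (a j : ℝ) ^ 2)) := by positivity
      linarith

/-- Transience of the simple random walk on `ℤ^d`, `d ≥ 3`. -/
lemma summable_rwP_zero (d : ℕ) (hd : 3 ≤ d) : Summable fun m => rwP d m 0 0 := by
  refine summable_of_sum_range_le (c := 43200) (fun m => rwP_nonneg d m 0 0) fun M => ?_
  have h := sum_range_rwP_le d hd M 0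
  have hp := lyapunov_pos d 0
  rw [div_mul_eq_mul_div, div_le_iff₀ (by norm_num)] at h
  exact le_of_mul_le_mul_left h hp

lemma green_zero_pos (d : ℕ) (hd : 3 ≤ d) : 0 < green d 0 0 :=
  (summable_rwP_zero d hd).tsum_pos (fun m => rwP_nonneg d m 0 0) 0 (by simp [rwP])

lemma rwP_add_right (d m : ℕ) (a b c : Zd d) : rwP d m (a + c) (b + c) = rwP d m a b := by
  induction m generalizing a with
  | zero => simp [rwP]
  | succ m ih =>
    simp only [rwP]
    congr 1
    refine Finset.sum_congr rfl fun i _ => Finset.sum_congr rfl fun s _ => ?_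
    rw [← ih]
    congr 1
    ext j
    by_cases hj : j = i
    · subst hj; simp [rwStep]; ring
    · simp [rwStep, Function.update_of_ne hj]

lemma green_self (d : ℕ) (a : Zd d) : green d a a = green d 0 0 := by
  simp only [green]
  congr 1
  ext m
  simpa using rwP_add_right d m 0 0 a

lemma tendsto_int_floor_mul_div (c : ℝ) :
    Tendsto (fun n : ℕ => (⌊(n : ℝ) * c⌋ : ℝ) / n) atTop (nhds c) := by
  have h0 : Tendsto (fun n : ℕ => c - 1 / (n : ℝ)) atTop (nhds c) := by
    simpa using (tendsto_one_div_atTop_nhds_zero_nat (𝕜 := ℝ)).const_sub c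
  refine tendsto_of_tendsto_of_tendsto_of_le_of_le' h0 tendsto_const_nhds ?_ ?_ <;>
    filter_upwards [eventually_gt_atTop 0] with n hn
  · have hn' : (0 : ℝ) < n := by exact_mod_cast hn
    rw [le_div_iff₀ hn', sub_mul, one_div_mul_cancel hn'.ne']
    linarith [Int.lt_floor_add_one ((n : ℝ) * c)]
  · have hn' : (0 : ℝ) < n := by exact_mod_cast hn
    rw [div_le_iff₀ hn']
    linarith [Int.floor_le ((n : ℝ) * c)]

open Classical in
lemma rectIdx_eq_piFinset (d : ℕ) {n : ℕ} (hn : 0 < n) (lo hi : Fin d → ℝ) :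
    rectIdx d n lo hi = Fintype.piFinset fun i =>
      Finset.Icc (max (⌊(n : ℝ) * lo i⌋ + 1) 0) (min ⌊(n : ℝ) * hi i⌋ ((n : ℤ) - 1)) := by
  have hn' : (0 : ℝ) < n := by exact_mod_cast hn
  ext a
  simp only [rectIdx, VN, rect, Finset.mem_filter, Fintype.mem_piFinset, Finset.mem_Icc,
    Set.mem_ofPred_eq, Set.mem_inter_iff, Set.mem_Icc, Set.mem_Ioc, ← forall_and]
  refine forall_congr' fun i => ?_
  rw [max_le_iff, le_min_iff, Int.add_one_le_iff, Int.floor_lt, Int.le_floor, ← lt_div_iff₀' hn',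
    ← div_le_iff₀' hn']
  constructor
  · rintro ⟨⟨h0, h1⟩, -, h2, h3⟩
    exact ⟨⟨h2, h0⟩, h3, h1⟩
  · rintro ⟨⟨h2, h0⟩, h3, h1⟩
    have h0' : (0 : ℝ) ≤ a i := by exact_mod_cast h0
    have h1' : (a i : ℝ) ≤ n := by exact_mod_cast (by omega : a i ≤ (n : ℤ))
    exact ⟨⟨h0, h1⟩, ⟨div_nonneg h0' hn'.le, (div_le_one hn').2 h1'⟩, h2, h3⟩

lemma volume_rect (d : ℕ) (lo hi : Fin d → ℝ) :
    (volume (rect d lo hi)).toReal = ∏ i, max (min (hi i) 1 - max (lo i) 0) 0 := by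
  have : rect d lo hi = Set.univ.pi fun i => Set.Icc (0 : ℝ) 1 ∩ Set.Ioc (lo i) (hi i) := by
    ext t; simp [rect]
  rw [this, volume_pi_pi, ENNReal.toReal_prod]
  refine Finset.prod_congr rfl fun i _ => ?_
  have h : (Set.Icc (0 : ℝ) 1 ∩ Set.Ioc (lo i) (hi i) : Set ℝ) =ᵐ[volume]
      (Set.Icc 0 1 ∩ Set.Icc (lo i) (hi i) : Set ℝ) :=
    (ae_eq_refl _).inter Ioc_ae_eq_Icc
  rw [measure_congr h, Set.Icc_inter_Icc, ← Measure.real, Real.volume_real_Icc, min_comm, max_comm 0]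

lemma tendsto_card_rectIdx_div (d : ℕ) (lo hi : Fin d → ℝ) :
    Tendsto (fun n : ℕ => ((rectIdx d n lo hi).card : ℝ) / (n : ℝ) ^ d) atTop
      (nhds (volume (rect d lo hi)).toReal) := by
  rw [volume_rect]
  have key : ∀ i : Fin d, Tendsto (fun n : ℕ =>
      max (min ((⌊(n : ℝ) * hi i⌋ : ℝ) / n) (1 - 1 / (n : ℝ)) + 1 / (n : ℝ) -
        max ((⌊(n : ℝ) * lo i⌋ : ℝ) / n + 1 / (n : ℝ)) 0) 0) atTop
      (nhds (max (min (hi i) 1 - max (lo i) 0) 0)) := by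
    intro i
    have h1 : Tendsto (fun n : ℕ => 1 / (n : ℝ)) atTop (nhds 0) :=
      tendsto_one_div_atTop_nhds_zero_nat
    have h := ((((tendsto_int_floor_mul_div (hi i)).min (h1.const_sub 1)).add h1).sub
      (((tendsto_int_floor_mul_div (lo i)).add h1).max (tendsto_const_nhds (x := (0 : ℝ))))).max
        (tendsto_const_nhds (x := (0 : ℝ)))
    simpa using h
  refine (tendsto_finsetProd _ fun i _ => key i).congr' ?_
  filter_upwards [eventually_gt_atTop 0] with n hn
  have hn' : (0 : ℝ) < n := by exact_mod_cast hn
  rw [rectIdx_eq_piFinset d hn, Fintype.card_piFinset, Nat.cast_prod]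
  rw [show (n : ℝ) ^ d = ∏ _i : Fin d, (n : ℝ) by simp, ← Finset.prod_div_distrib]
  refine Finset.prod_congr rfl fun i _ => ?_
  rw [Int.card_Icc]
  have hcast : ∀ z : ℤ, ((z.toNat : ℕ) : ℝ) = max (z : ℝ) 0 := fun z => by
    rw [← Int.cast_natCast, Int.toNat_eq_max]; push_cast; rfl
  rw [hcast]
  push_cast
  have e1 : 1 - 1 / (n : ℝ) = (n - 1) / n := by field_simp
  have e2 : (0 : ℝ) = 0 / n := (zero_div _).symm
  rw [e1, e2, ← add_div, max_div_div_right hn'.le, min_div_div_right hn'.le, ← add_div, ← sub_div,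
    max_div_div_right hn'.le, zero_div]

lemma gaussianReal_preimage_affine {g b : ℝ} (hg : 0 < g) (hb : 0 < b) {S : Set ℝ}
    (hS : MeasurableSet S) :
    (gaussianReal 0 g.toNNReal {t | (b / g) * t + -(b ^ 2 / g) ∈ S}).toReal =
      (√(2 * π * (b ^ 2 / g)))⁻¹ * exp (-(b ^ 2 / g) / 2) *
        ∫ w in S, exp (-w) * exp (-w ^ 2 / (2 * (b ^ 2 / g))) := by
  obtain ⟨β, hβ⟩ : ∃ β, β = b ^ 2 / g := ⟨_, rfl⟩
  have hβ0 : 0 < β := by rw [hβ]; positivity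
  have hmap : (gaussianReal 0 g.toNNReal).map (fun t => (b / g) * t + -(b ^ 2 / g)) =
      gaussianReal (-β) β.toNNReal := by
    have h := gaussianReal_map_const_mul (μ := 0) (v := g.toNNReal) (b / g)
    have h' := gaussianReal_map_add_const (μ := b / g * 0)
      (v := NNReal.mk ((b / g) ^ 2) (sq_nonneg _) * g.toNNReal) (-(b ^ 2 / g))
    rw [← h, Measure.map_map (by fun_prop) (by fun_prop)] at h'
    refine h'.trans ?_
    congr 1
    · rw [hβ]; ring
    · ext
      simp only [NNReal.coe_mul, NNReal.coe_mk, Real.coe_toNNReal _ hg.le,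
        Real.coe_toNNReal _ hβ0.le]
      rw [hβ]
      field_simp
  have hpre : {t | (b / g) * t + -(b ^ 2 / g) ∈ S} =
    (fun t => (b / g) * t + -(b ^ 2 / g)) ⁻¹' S := rfl
  rw [hpre, ← Measure.map_apply (by fun_prop) hS, hmap,
    gaussianReal_apply_eq_integral _ (by simpa using hβ0),
    ENNReal.toReal_ofReal (integral_nonneg fun _ => gaussianPDFReal_nonneg _ _ _), ← hβ,
    ← integral_const_mul]
  refine integral_congr_ae (Eventually.of_forall fun w => ?_)
  simp only [gaussianPDFReal, Real.coe_toNNReal _ hβ0.le]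
  rw [← exp_add, mul_assoc (√_)⁻¹, ← exp_add]
  congr 2
  field_simp
  ring

lemma tendsto_log_add_div_sqrt (c : ℝ) :
    Tendsto (fun L : ℝ => (log L + c) / (2 * √(2 * L))) atTop (nhds 0) := by
  have h1 : Tendsto (fun L : ℝ => log L / L ^ (1 / 2 : ℝ)) atTop (nhds 0) :=
    (isLittleO_log_rpow_atTop (by norm_num)).tendsto_div_nhds_zero
  have h2 : Tendsto (fun L : ℝ => c / L ^ (1 / 2 : ℝ)) atTop (nhds 0) :=
    (tendsto_rpow_atTop (by norm_num)).const_div_atTop c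
  have h := (h1.add h2).div_const (2 * √2)
  rw [add_zero, zero_div] at h
  refine h.congr fun L => ?_
  rw [Real.sqrt_mul (by norm_num), ← add_div, div_div, Real.sqrt_eq_rpow L]
  ring_nf

lemma tendsto_log_natCast : Tendsto (fun N : ℕ => log (N : ℝ)) atTop atTop :=
  tendsto_log_atTop.comp tendsto_natCast_atTop_atTop

lemma tendsto_bN_atTop {g : ℝ} (hg : 0 < g) : Tendsto (fun N : ℕ => bN g N) atTop atTop := by
  have hs : Tendsto (fun L : ℝ => √(2 * L)) atTop atTop :=
    tendsto_sqrt_atTop.comp (tendsto_id.const_mul_atTop two_pos)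
  have h : Tendsto (fun L : ℝ => √(2 * L) - (log L + log (4 * π)) / (2 * √(2 * L))) atTop atTop := by
    simpa only [sub_eq_add_neg] using
      hs.atTop_add (tendsto_log_add_div_sqrt (log (4 * π))).neg
  exact (h.comp tendsto_log_natCast).const_mul_atTop (Real.sqrt_pos.2 hg)

lemma tendsto_normalization {g : ℝ} (hg : 0 < g) :
    Tendsto (fun N : ℕ => (N : ℝ) * ((√(2 * π * (bN g N ^ 2 / g)))⁻¹ *
      exp (-(bN g N ^ 2 / g) / 2))) atTop (nhds 1) := by
  have hδ := tendsto_log_add_div_sqrt (log (4 * π))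
  have hs : Tendsto (fun L : ℝ => √(2 * L)) atTop atTop :=
    tendsto_sqrt_atTop.comp (tendsto_id.const_mul_atTop two_pos)
  have hδs : Tendsto (fun L : ℝ => (log L + log (4 * π)) / (2 * √(2 * L)) / √(2 * L)) atTop
      (nhds 0) := hδ.div_atTop hs
  have hlim : Tendsto (fun L : ℝ => (1 - (log L + log (4 * π)) / (2 * √(2 * L)) / √(2 * L))⁻¹ *
      exp (-((log L + log (4 * π)) / (2 * √(2 * L))) ^ 2 / 2)) atTop (nhds 1) := by
    have h1 := (hδs.const_sub 1).inv₀ (by norm_num)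
    have h2 := (continuous_exp.tendsto _).comp ((hδ.pow 2).neg.div_const 2)
    simpa using h1.mul h2
  refine (hlim.comp tendsto_log_natCast).congr' ?_
  filter_upwards [(tendsto_bN_atTop hg).eventually_gt_atTop 0,
    tendsto_log_natCast.eventually_gt_atTop 0, eventually_gt_atTop 0] with N hb hL hN
  have hN' : (0 : ℝ) < N := by exact_mod_cast hN
  have hNexp : (N : ℝ) = exp (log N) := (exp_log hN').symm
  simp only [Function.comp_apply]
  have hbN : bN g N = √g * (√(2 * log N) - (log (log N) + log (4 * π)) / (2 * √(2 * log N))) := rfl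
  generalize log (N : ℝ) = L at hNexp hL hbN
  have hs0 : 0 < √(2 * L) := Real.sqrt_pos.2 (by positivity)
  have hs2 : √(2 * L) ^ 2 = 2 * L := Real.sq_sqrt (by positivity)
  have hsδ : √(2 * L) * ((log L + log (4 * π)) / (2 * √(2 * L))) = log (√(2 * π) * √(2 * L)) := by
    rw [← Real.sqrt_mul (by positivity), Real.log_sqrt (by positivity),
      ← Real.log_mul hL.ne' (by positivity)]
    field_simp
    ring_nf
  generalize (log L + log (4 * π)) / (2 * √(2 * L)) = δ at hsδ hbN
  generalize √(2 * L) = s at *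
  have hg' : 0 < √g := Real.sqrt_pos.2 hg
  have hc : 0 < s - δ := by rw [hbN] at hb; exact pos_of_mul_pos_right hb hg'.le
  have hβ : bN g N ^ 2 / g = (s - δ) ^ 2 := by
    rw [hbN, mul_pow, Real.sq_sqrt hg.le]; field_simp
  have hπ : 0 < √(2 * π) := by positivity
  rw [hβ, Real.sqrt_mul (by positivity), Real.sqrt_sq hc.le, hNexp,
    mul_left_comm, ← exp_add,
    show L + -(s - δ) ^ 2 / 2 = s * δ + -δ ^ 2 / 2 by linear_combination -hs2 / 2,
    exp_add, hsδ, exp_log (by positivity)]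
  have : s - δ ≠ 0 := hc.ne'
  have : 1 - δ / s ≠ 0 := by
    rw [one_sub_div hs0.ne']; exact (div_pos hc hs0).ne'
  field_simp

/-- The interval `(x, y]` of real numbers, for `y ∈ (-∞, +∞]`. -/
def realIoc (x : ℝ) (y : EReal) : Set ℝ := {w | x < w ∧ (w : EReal) ≤ y}

lemma measurableSet_realIoc (x : ℝ) (y : EReal) : MeasurableSet (realIoc x y) :=
  measurableSet_Ioi.inter (measurable_coe_real_ereal measurableSet_Iic)

lemma integral_exp_neg_realIoc {x : ℝ} {y : EReal} (hxy : (x : EReal) < y) :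
    ∫ w in realIoc x y, exp (-w) = exp (-x) - expE y := by
  induction y with
  | bot => simp at hxy
  | top =>
    have : realIoc x ⊤ = Set.Ioi x := by ext; simp [realIoc]
    simp only [this, integral_exp_neg_Ioi, expE, if_true, sub_zero]
  | coe y =>
    have hxy' : x < y := by exact_mod_cast hxy
    have : realIoc x y = Set.Ioc x y := by ext; simp [realIoc]
    rw [this, ← intervalIntegral.integral_of_le hxy'.le]
    simp [expE]

lemma setOf_uN_eq {g : ℝ} (hg : 0 < g) {N : ℕ} (hb : 0 < bN g N) {x : ℝ} {y : EReal}
    (hxy : (x : EReal) < y) :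
    {t : ℝ | (uN g N x : EReal) < t ∧ (t : EReal) ≤ uNE g N y} =
      {t | (bN g N / g) * t + -(bN g N ^ 2 / g) ∈ realIoc x y} := by
  have key : ∀ t : ℝ, (bN g N / g) * t + -(bN g N ^ 2 / g) = (t - bN g N) / (g / bN g N) := by
    intro t; field_simp; ring
  have ha : 0 < g / bN g N := by positivity
  ext t
  simp only [Set.mem_ofPred_eq, realIoc, key, lt_div_iff₀' ha, EReal.coe_lt_coe_iff, uN, aN,
    lt_sub_iff_add_lt]
  refine and_congr_right fun _ => ?_
  induction y with
  | bot => simp at hxy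
  | top => simp [uNE]
  | coe y =>
    simp only [uNE, uN, aN, EReal.coe_ne_top, if_false, EReal.toReal_coe, EReal.coe_le_coe_iff]
    rw [div_le_iff₀' ha, sub_le_iff_le_add]

lemma tendsto_nat_mul_gaussianReal {g : ℝ} (hg : 0 < g) {x : ℝ} {y : EReal}
    (hxy : (x : EReal) < y) :
    Tendsto (fun N : ℕ => (N : ℝ) * (gaussianReal 0 g.toNNReal
      {t : ℝ | (uN g N x : EReal) < t ∧ (t : EReal) ≤ uNE g N y}).toReal) atTop
      (nhds (exp (-x) - expE y)) := by
  have hβ : Tendsto (fun N : ℕ => bN g N ^ 2 / g) atTop atTop :=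
    ((tendsto_pow_atTop two_ne_zero).comp (tendsto_bN_atTop hg)).atTop_div_const hg
  have hint : Tendsto (fun N : ℕ => ∫ w in realIoc x y,
      exp (-w) * exp (-w ^ 2 / (2 * (bN g N ^ 2 / g)))) atTop (nhds (exp (-x) - expE y)) := by
    rw [← integral_exp_neg_realIoc hxy]
    refine tendsto_integral_filter_of_dominated_convergence (fun w => exp (-w)) ?_ ?_ ?_ ?_
    · exact Eventually.of_forall fun N => by fun_prop
    · refine Eventually.of_forall fun N => Eventually.of_forall fun w => ?_
      rw [Real.norm_of_nonneg (by positivity)]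
      refine mul_le_of_le_one_right (exp_pos _).le (exp_le_one_iff.2 ?_)
      rw [neg_div]
      exact neg_nonpos.2 (by positivity)
    · exact (integrableOn_exp_neg_Ioi x).mono_set fun w hw => hw.1
    · refine Eventually.of_forall fun w => ?_
      have h := (continuous_exp.tendsto _).comp
        ((hβ.const_mul_atTop two_pos).const_div_atTop (-w ^ 2))
      simpa using h.const_mul (exp (-w))
  have h := (tendsto_normalization hg).mul hint
  rw [one_mul] at h
  refine h.congr' ?_
  filter_upwards [(tendsto_bN_atTop hg).eventually_gt_atTop 0] with N hb
  rw [setOf_uN_eq hg hb hxy, gaussianReal_preimage_affine hg hb (measurableSet_realIoc x y)]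
  ring

lemma IsGaussianField.map_eq {Ω : Type*} [MeasurableSpace Ω] {P : Measure Ω} {d : ℕ}
    {G : Zd d → Zd d → ℝ} {φ : Zd d → Ω → ℝ} (hφ : IsGaussianField P d G φ) (a : Zd d) :
    P.map (φ a) = gaussianReal 0 (G a a).toNNReal := by
  have h := hφ.2 (Finsupp.single a 1)
  rw [Finsupp.support_single a one_ne_zero] at h
  simpa using h

/-- For every bounded rectangle `A ⊆ [0,1]^d` and all `x < y ≤ +∞`, the sum
over `α ∈ nA ∩ V_N` of `P(u_N(x) < φ_α ≤ u_N(y))` converges to `|A|(e^{-x} - e^{-y})`. -/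
theorem extremal_mean_measure_infinite_volume
    (d : ℕ) (hd : 3 ≤ d)
    {Ω : Type*} [MeasurableSpace Ω] (P : Measure Ω) [IsProbabilityMeasure P]
    (φ : Zd d → Ω → ℝ) (hφ : IsGaussianField P d (green d) φ)
    (lo hi : Fin d → ℝ) (hlohi : ∀ i, lo i < hi i)
    (x : ℝ) (y : EReal) (hxy : (x : EReal) < y) :
    Tendsto
      (fun n : ℕ =>
        ∑ a ∈ rectIdx d n lo hi,
          (P {ω | (uN (green d 0 0) (n ^ d) x : EReal) < (φ a ω : EReal) ∧
                  (φ a ω : EReal) ≤ uNE (green d 0 0) (n ^ d) y}).toReal)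
      atTop
      (nhds ((volume (rect d lo hi)).toReal * (Real.exp (-x) - expE y))) := by
  have hg := green_zero_pos d hd
  have hlim := (tendsto_card_rectIdx_div d lo hi).mul
    ((tendsto_nat_mul_gaussianReal hg hxy).comp
      (tendsto_pow_atTop (α := ℕ) (by omega : d ≠ 0)))
  refine hlim.congr' ?_
  filter_upwards [eventually_gt_atTop 0, (tendsto_bN_atTop hg).comp
    (tendsto_pow_atTop (α := ℕ) (by omega : d ≠ 0)) |>.eventually_gt_atTop 0] with n hn hb
  have hprob : ∀ a, P {ω | (uN (green d 0 0) (n ^ d) x : EReal) < (φ a ω : EReal) ∧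
      (φ a ω : EReal) ≤ uNE (green d 0 0) (n ^ d) y} =
      gaussianReal 0 (green d 0 0).toNNReal {t : ℝ | (uN (green d 0 0) (n ^ d) x : EReal) < t ∧
        (t : EReal) ≤ uNE (green d 0 0) (n ^ d) y} := by
    intro a
    rw [← green_self d a, ← hφ.map_eq a, Measure.map_apply (hφ.1 a)]
    · rfl
    · exact (measurable_coe_real_ereal measurableSet_Ioi).inter
        (measurable_coe_real_ereal measurableSet_Iic)
  have hn' : (n : ℝ) ^ d ≠ 0 := by positivity
  simp only [hprob, Finset.sum_const, nsmul_eq_mul, Function.comp_apply, Nat.cast_pow]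
  field_simp
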